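/- Let Q be a finite set of atoms, X, Y ⊆ vars(Q), z a variable, and c a constant, and let Q' = Q[z→c]. If FD(Q) ⊨ X → Y, then FD(Q') ⊨ (X \ {z}) → (Y \ {z}). -/

import Mathlib

attribute [local instance] Classical.propDecidable

noncomputable section

/-- A term is either a variable (`Sum.inl v`) or a constant (`Sum.inr c`),
variables and constants both being coded by natural numbers
(the two copies of `ℕ` are disjoint). -/
abbrev Trm := ℕ ⊕ ℕ

/-- A database schema assigns to every relation name (a natural number) an
arity `n` and a primary-key length `k` with `n ≥ k ≥ 1`; the primary key
consists of the first `k` positions. -/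
structure Schema where
  arity : ℕ → ℕ
  keyLen : ℕ → ℕ
  keyLen_le_arity : ∀ R, keyLen R ≤ arity R
  one_le_keyLen : ∀ R, 1 ≤ keyLen R

/-- An atom: a relation name together with a list of arguments. -/
structure Atom where
  rel : ℕ
  args : List Trm
deriving DecidableEq

/-- Variables occurring in a list of terms. -/
def varsL (l : List Trm) : Finset ℕ := (l.filterMap Sum.getLeft?).toFinset

/-- Constants occurring in a list of terms. -/
def constsL (l : List Trm) : Finset ℕ := (l.filterMap Sum.getRight?).toFinset

/-- All variables of an atom. -/
def varsA (A : Atom) : Finset ℕ := varsL A.args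

/-- Key variables of an atom: variables in the primary-key positions. -/
def keyVars (S : Schema) (A : Atom) : Finset ℕ := varsL (A.args.take (S.keyLen A.rel))

/-- Constants of an atom. -/
def constsA (A : Atom) : Finset ℕ := constsL A.args

/-- Well-formed atom: number of arguments equals the arity of its relation name. -/
def wfAtom (S : Schema) (A : Atom) : Prop := A.args.length = S.arity A.rel

/-- A fact is an atom without variables. -/
def isFact (A : Atom) : Prop := ∀ t ∈ A.args, ∃ c : ℕ, t = Sum.inr c

/-- Two (facts) are key-equal: same relation name, and same primary-key positions. -/
def keyEqual (S : Schema) (A B : Atom) : Prop :=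
  A.rel = B.rel ∧ A.args.take (S.keyLen A.rel) = B.args.take (S.keyLen B.rel)

/-- The block of `A` in `db`: all facts of `db` key-equal to `A`. -/
def block (S : Schema) (A : Atom) (db : Finset Atom) : Finset Atom :=
  db.filter (fun B => keyEqual S A B)

/-- An uncertain database: a finite set of well-formed facts. -/
def IsDb (S : Schema) (db : Finset Atom) : Prop := ∀ A ∈ db, isFact A ∧ wfAtom S A

/-- A set of facts is consistent if it contains no two distinct key-equal facts. -/
def Consistent (S : Schema) (db : Finset Atom) : Prop :=
  ∀ A ∈ db, ∀ B ∈ db, keyEqual S A B → A = B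

/-- A repair of `db`: a maximal consistent subset of `db`. -/
def IsRepair (S : Schema) (db r : Finset Atom) : Prop :=
  r ⊆ db ∧ Consistent S r ∧
    ∀ r' : Finset Atom, r ⊆ r' → r' ⊆ db → Consistent S r' → r' = r

/-- Applying a valuation (a total map from variables to constants) to a term. -/
def appT (θ : ℕ → ℕ) : Trm → Trm
  | Sum.inl v => Sum.inr (θ v)
  | Sum.inr c => Sum.inr c

/-- Applying a valuation to an atom. -/
def appA (θ : ℕ → ℕ) (A : Atom) : Atom := ⟨A.rel, A.args.map (appT θ)⟩

/-- Applying a valuation to a query. -/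
def appQ (θ : ℕ → ℕ) (q : Finset Atom) : Finset Atom := q.image (appA θ)

/-- `db ⊨ q`: some valuation sends every atom of `q` into `db`. -/
def Sat (db q : Finset Atom) : Prop := ∃ θ : ℕ → ℕ, appQ θ q ⊆ db

/-- `db ∈ CERTAINTY(q)`: every repair of `db` satisfies `q`. -/
def Certainty (S : Schema) (q db : Finset Atom) : Prop :=
  ∀ r : Finset Atom, IsRepair S db r → Sat r q

/-- Variables of a query. -/
def varsQ (q : Finset Atom) : Finset ℕ := q.biUnion varsA

/-- Constants of a query. -/
def constsQ (q : Finset Atom) : Finset ℕ := q.biUnion constsA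

/-- `q` has no self-join: no two distinct atoms share a relation name. -/
def NoSelfJoin (q : Finset Atom) : Prop := ∀ F ∈ q, ∀ G ∈ q, F.rel = G.rel → F = G

/-- `db` is purified relative to `q`. -/
def Purified (q db : Finset Atom) : Prop :=
  ∀ A ∈ db, ∃ θ : ℕ → ℕ, A ∈ appQ θ q ∧ appQ θ q ⊆ db

/-- Active domain of a database: all constants occurring in its facts. -/
def adom (db : Finset Atom) : Finset ℕ := db.biUnion constsA

/-- Membership in the attribute closure of `X` under a set `FDs` of
functional dependencies (standard implication of functional dependencies). -/
inductive InCl (FDs : Set (Finset ℕ × Finset ℕ)) (X : Finset ℕ) : ℕ → Prop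
  | base {x : ℕ} : x ∈ X → InCl FDs X x
  | step {Z W : Finset ℕ} {w : ℕ} : (Z, W) ∈ FDs → (∀ z ∈ Z, InCl FDs X z) →
      w ∈ W → InCl FDs X w

/-- `FDs ⊨ X → Y`. -/
def FDImp (FDs : Set (Finset ℕ × Finset ℕ)) (X Y : Finset ℕ) : Prop :=
  ∀ y ∈ Y, InCl FDs X y

/-- `FD(q) = { key(F) → vars(F) : F ∈ q }`. -/
def FDq (S : Schema) (q : Finset Atom) : Set (Finset ℕ × Finset ℕ) :=
  {p | ∃ F ∈ q, p = (keyVars S F, varsA F)}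

/-- `F^{+,q} = {x ∈ vars(q) : FD(q \ {F}) ⊨ key(F) → x}`. -/
def plusCl (S : Schema) (q : Finset Atom) (F : Atom) : Set ℕ :=
  {x | x ∈ varsQ q ∧ InCl (FDq S (q.erase F)) (keyVars S F) x}

/-- `F^{⊕,q} = {x ∈ vars(q) : FD(q) ⊨ key(F) → x}`. -/
def oplusCl (S : Schema) (q : Finset Atom) (F : Atom) : Set ℕ :=
  {x | x ∈ varsQ q ∧ InCl (FDq S q) (keyVars S F) x}

/-- A (simple) path in an undirected graph given by edge relation `E`. -/
def IsPath (E : Atom → Atom → Prop) (p : List Atom) : Prop :=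
  p ≠ [] ∧ p.Nodup ∧ List.Chain' E p

/-- `E` is (the edge relation of) a join tree for `q`: a tree (unique simple
paths between any two vertices) on the atoms of `q` satisfying the
Connectedness Condition. -/
def IsJoinTree (q : Finset Atom) (E : Atom → Atom → Prop) : Prop :=
  (∀ a b, E a b → E b a) ∧
  (∀ a b, E a b → a ∈ q ∧ b ∈ q ∧ a ≠ b) ∧
  (∀ a ∈ q, ∀ b ∈ q, ∃! p : List Atom,
      IsPath E p ∧ p.head? = some a ∧ p.getLast? = some b) ∧
  (∀ x : ℕ, ∀ F ∈ q, ∀ G ∈ q, x ∈ varsA F → x ∈ varsA G →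
      ∀ p : List Atom, IsPath E p → p.head? = some F → p.getLast? = some G →
        ∀ H ∈ p, x ∈ varsA H)

/-- The consecutive pairs (edges) of a path. -/
def edgePairs (p : List Atom) : List (Atom × Atom) := p.zip p.tail

/-- `F ↝ G` in the attack graph of the join tree `E` of `q`: `F ≠ G` are atoms
of `q`, and no label `vars(H) ∩ vars(H')` of an edge on the (unique) path from
`F` to `G` is contained in `F^{+,q}`. -/
def Attacks (S : Schema) (q : Finset Atom) (E : Atom → Atom → Prop) (F G : Atom) : Prop :=
  F ∈ q ∧ G ∈ q ∧ F ≠ G ∧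
  ∀ p : List Atom, IsPath E p → p.head? = some F → p.getLast? = some G →
    ∀ e ∈ edgePairs p, ¬ ((↑(varsA e.1 ∩ varsA e.2) : Set ℕ) ⊆ plusCl S q F)

/-- The attack `F ↝ G` is weak: `key(G) ⊆ F^{⊕,q}`. -/
def Weak (S : Schema) (q : Finset Atom) (F G : Atom) : Prop :=
  (↑(keyVars S G) : Set ℕ) ⊆ oplusCl S q F

/-- Consecutive pairs of a cyclic sequence, including the wrap-around pair. -/
def cyclePairs (L : List Atom) : List (Atom × Atom) := L.zip (L.rotate 1)

/-- `L` is an (elementary directed) cycle in the directed graph `att`. -/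
def IsCycle (att : Atom → Atom → Prop) (L : List Atom) : Prop :=
  2 ≤ L.length ∧ L.Nodup ∧ ∀ e ∈ cyclePairs L, att e.1 e.2

/-- A cycle is terminal: no edge leads from a vertex in the cycle to a vertex
outside the cycle. -/
def TerminalCycle (att : Atom → Atom → Prop) (L : List Atom) : Prop :=
  ∀ a ∈ L, ∀ b, att a b → b ∈ L

/-- A strong cycle in the attack graph: a cycle at least one attack of which is strong. -/
def StrongCycle (S : Schema) (q : Finset Atom) (E : Atom → Atom → Prop)
    (L : List Atom) : Prop :=
  IsCycle (Attacks S q E) L ∧ ∃ e ∈ cyclePairs L, ¬ Weak S q e.1 e.2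

/-- Substituting constant `c` for variable `z` in a term. -/
def substT (z c : ℕ) : Trm → Trm
  | Sum.inl v => if v = z then Sum.inr c else Sum.inl v
  | Sum.inr d => Sum.inr d

/-- `F[z→c]`. -/
def substA (z c : ℕ) (A : Atom) : Atom := ⟨A.rel, A.args.map (substT z c)⟩

/-- `q[z→c]`. -/
def substQ (z c : ℕ) (q : Finset Atom) : Finset Atom := q.image (substA z c)

/-- Simultaneous substitution of the constants `bs` for the (distinct)
variables `xs` (componentwise) in a term. -/
def substLT (xs bs : List ℕ) : Trm → Trm
  | Sum.inl v => if v ∈ xs then Sum.inr (bs.getD (xs.idxOf v) 0) else Sum.inl v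
  | Sum.inr d => Sum.inr d

/-- `F[x⃗→b⃗]`. -/
def substLA (xs bs : List ℕ) (A : Atom) : Atom := ⟨A.rel, A.args.map (substLT xs bs)⟩

/-- `q[x⃗→b⃗]`. -/
def substLQ (xs bs : List ℕ) (q : Finset Atom) : Finset Atom := q.image (substLA xs bs)

/-- First-order formulas over the relational vocabulary (relation names and
constants coded by naturals, variables coded by naturals). -/
inductive Fml where
  | atom (R : ℕ) (args : List Trm)
  | eq (s t : Trm)
  | tru
  | not (φ : Fml)
  | and (φ ψ : Fml)
  | or (φ ψ : Fml)
  | ex (v : ℕ) (φ : Fml)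
  | all (v : ℕ) (φ : Fml)

/-- Value of a term under an assignment of constants to variables. -/
def evalT (σ : ℕ → ℕ) : Trm → ℕ
  | Sum.inl v => σ v
  | Sum.inr c => c

/-- Satisfaction of a first-order formula in the finite structure whose
relations are given by the facts of `db`, with quantifiers ranging over `dom`. -/
def Holds (db : Finset Atom) (dom : Finset ℕ) : Fml → (ℕ → ℕ) → Prop
  | .atom R args, σ => (⟨R, args.map fun t => Sum.inr (evalT σ t)⟩ : Atom) ∈ db
  | .eq s t, σ => evalT σ s = evalT σ t
  | .tru, _ => True
  | .not φ, σ => ¬ Holds db dom φ σ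
  | .and φ ψ, σ => Holds db dom φ σ ∧ Holds db dom ψ σ
  | .or φ ψ, σ => Holds db dom φ σ ∨ Holds db dom ψ σ
  | .ex v φ, σ => ∃ a ∈ dom, Holds db dom φ (Function.update σ v a)
  | .all v φ, σ => ∀ a ∈ dom, Holds db dom φ (Function.update σ v a)

/-- Free variables of a formula. -/
def Fml.free : Fml → Finset ℕ
  | .atom _ args => varsL args
  | .eq s t => varsL [s, t]
  | .tru => ∅
  | .not φ => φ.free
  | .and φ ψ => φ.free ∪ ψ.free
  | .or φ ψ => φ.free ∪ ψ.free
  | .ex v φ => φ.free.erase v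
  | .all v φ => φ.free.erase v

/-- Relation names occurring in a formula. -/
def Fml.rels : Fml → Finset ℕ
  | .atom R _ => {R}
  | .eq _ _ => ∅
  | .tru => ∅
  | .not φ => φ.rels
  | .and φ ψ => φ.rels ∪ ψ.rels
  | .or φ ψ => φ.rels ∪ ψ.rels
  | .ex _ φ => φ.rels
  | .all _ φ => φ.rels

/-- Constants occurring in a formula. -/
def Fml.consts : Fml → Finset ℕ
  | .atom _ args => constsL args
  | .eq s t => constsL [s, t]
  | .tru => ∅
  | .not φ => φ.consts
  | .and φ ψ => φ.consts ∪ ψ.consts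
  | .or φ ψ => φ.consts ∪ ψ.consts
  | .ex _ φ => φ.consts
  | .all _ φ => φ.consts

/-- Well-formed formula: every atom has as many arguments as the arity of its
relation name. -/
def FmlWf (S : Schema) : Fml → Prop
  | .atom R args => args.length = S.arity R
  | .eq _ _ => True
  | .tru => True
  | .not φ => FmlWf S φ
  | .and φ ψ => FmlWf S φ ∧ FmlWf S ψ
  | .or φ ψ => FmlWf S φ ∧ FmlWf S ψ
  | .ex _ φ => FmlWf S φ
  | .all _ φ => FmlWf S φ

/-- The safety predicate of Dalvi, Ré and Suciu (rules SE1–SE4). -/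
inductive Safe (S : Schema) : Finset Atom → Prop
  | se1 (A : Atom) : isFact A → Safe S {A}
  | se2 (q₁ q₂ : Finset Atom) : q₁.Nonempty → q₂.Nonempty →
      Disjoint (varsQ q₁) (varsQ q₂) → Safe S q₁ → Safe S q₂ → Safe S (q₁ ∪ q₂)
  | se3 (q : Finset Atom) (x a : ℕ) : (∀ F ∈ q, x ∈ keyVars S F) →
      Safe S (substQ x a q) → Safe S q
  | se4 (q : Finset Atom) (F : Atom) (x a : ℕ) : F ∈ q → keyVars S F = ∅ →
      varsA F ≠ ∅ → x ∈ varsA F → Safe S (substQ x a q) → Safe S q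

/-- The atom `R_i(x_i ; x_{i+1})` (with `x_{k+1} = x_1`) of the query `acq_k`;
variable `x_i` is coded by `i`, relation name `R_i` by `i`. -/
def Ratom (k i : ℕ) : Atom := ⟨i, [Sum.inl i, Sum.inl (i % k + 1)]⟩

/-- The all-key atom `S_k(x_1,…,x_k)` of the query `acq_k`;
relation name `S_k` is coded by `0`. -/
def Satom (k : ℕ) : Atom := ⟨0, (List.range k).map (fun j => Sum.inl (j + 1))⟩

/-- The query `acq_k = {R_1(x_1;x_2), …, R_k(x_k;x_1), S_k(x_1,…,x_k)}`. -/
def acq (k : ℕ) : Finset Atom := ((Finset.Icc 1 k).image (Ratom k)) ∪ {Satom k}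

/-- Sum of `Pr` over the possible (= consistent) worlds of `db` satisfying `P`. -/
def prOf (S : Schema) (db : Finset Atom) (Pr : Finset Atom → ℚ)
    (P : Finset Atom → Prop) : ℚ :=
  ∑ w ∈ db.powerset.filter (fun w => Consistent S w ∧ P w), Pr w

end
theorem mem_varsL_aux (l : List Trm) (v : ℕ) : v ∈ varsL l ↔ Sum.inl v ∈ l := by
  simp [varsL, List.mem_filterMap]

theorem varsL_subst_aux (z c : ℕ) (l : List Trm) (v : ℕ) :
    v ∈ varsL (l.map (substT z c)) ↔ v ∈ varsL l ∧ v ≠ z := by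
  rw [mem_varsL_aux, mem_varsL_aux, List.mem_map]
  constructor
  · rintro ⟨t, ht, he⟩
    rcases t with w | d
    · by_cases hw : w = z
      · simp [substT, hw] at he
      · simp only [substT, if_neg hw, Sum.inl.injEq] at he
        subst he
        exact ⟨ht, hw⟩
    · simp [substT] at he
  · rintro ⟨h, hv⟩
    exact ⟨Sum.inl v, h, by simp [substT, hv]⟩

theorem inCl_subst_aux (S : Schema) (Q : Finset Atom) (X : Finset ℕ) (z c y : ℕ)
    (h : InCl (FDq S Q) X y) (hy : y ≠ z) :
    InCl (FDq S (substQ z c Q)) (X.erase z) y := by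
  induction h with
  | base hx => exact InCl.base (Finset.mem_erase.2 ⟨hy, hx⟩)
  | step hF _ hw ih =>
    obtain ⟨F, hFQ, he⟩ := hF
    obtain ⟨rfl, rfl⟩ := Prod.mk.inj he
    refine InCl.step (Z := keyVars S (substA z c F)) (W := varsA (substA z c F))
      ⟨substA z c F, Finset.mem_image_of_mem _ hFQ, rfl⟩ ?_ ?_
    · intro v hv
      simp only [keyVars, substA, ← List.map_take] at hv
      have hv2 := (varsL_subst_aux z c _ v).1 hv
      exact ih v hv2.1 hv2.2
    · exact (varsL_subst_aux z c _ _).2 ⟨hw, hy⟩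

/-- If `FD(Q) ⊨ X → Y` then `FD(Q[z→c]) ⊨ (X \ {z}) → (Y \ {z})`. -/
theorem statement6 (S : Schema) (Q : Finset Atom) (hQ : ∀ F ∈ Q, wfAtom S F)
    (X Y : Finset ℕ) (hX : X ⊆ varsQ Q) (hY : Y ⊆ varsQ Q)
    (z c : ℕ) (h : FDImp (FDq S Q) X Y) :
    FDImp (FDq S (substQ z c Q)) (X.erase z) (Y.erase z) := by
  intro y hy
  rw [Finset.mem_erase] at hy
  exact inCl_subst_aux S Q X z c y (h y hy.2) hy.1
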